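/- Let μ ∈ Δ⁺_l. Then: (i) #(Ab_μ) > 1 if and only if (μ, θ) = 0; (ii) if (μ, θ) = 0, then the set Ab_μ \ {I(μ)_min} is nonempty and has a unique minimal element with respect to inclusion, namely I′ = I(μ)_min ∪ {w_μ⁻¹(θ)}, and the minuscule element corresponding to I′ is s₀·w_μ·s₀, where s₀ = s_{α₀}. -/

import Mathlib

open scoped BigOperators

/-- Data of a reduced irreducible crystallographic root system `Δ`, spanning a
`ℚ`-vector space `V` equipped with a Weyl-group-invariant inner product `B`,
together with a chosen system of positive roots `Pos` and the highest root `θ`. -/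
structure RootSystemCtx (V : Type*) [AddCommGroup V] [Module ℚ V] where
  /-- the invariant inner product `( , )` -/
  B : V →ₗ[ℚ] V →ₗ[ℚ] ℚ
  B_symm : ∀ x y : V, B x y = B y x
  B_posdef : ∀ x : V, x ≠ 0 → 0 < B x x
  /-- the set of roots -/
  Δ : Set V
  Δ_finite : Δ.Finite
  Δ_spans : Submodule.span ℚ Δ = ⊤
  zero_notMem_Δ : (0 : V) ∉ Δ
  neg_mem_Δ : ∀ α ∈ Δ, -α ∈ Δ
  reduced : ∀ α ∈ Δ, ∀ c : ℚ, c • α ∈ Δ → c = 1 ∨ c = -1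
  crystallographic : ∀ α ∈ Δ, ∀ β ∈ Δ, ∃ n : ℤ, 2 * B α β / B β β = (n : ℚ)
  reflect_mem : ∀ α ∈ Δ, ∀ β ∈ Δ, β - (2 * B β α / B α α) • α ∈ Δ
  irreducible : ∀ S : Set V, S ⊆ Δ → (∀ α ∈ S, ∀ β ∈ Δ \ S, B α β = 0) → S = ∅ ∨ S = Δ
  /-- the positive roots `Δ⁺` -/
  Pos : Set V
  pos_subset : Pos ⊆ Δ
  mem_pos_or_neg_pos : ∀ α ∈ Δ, α ∈ Pos ∨ -α ∈ Pos
  pos_not_neg : ∀ α ∈ Pos, -α ∉ Pos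
  add_pos_mem : ∀ α ∈ Pos, ∀ β ∈ Pos, α + β ∈ Δ → α + β ∈ Pos
  /-- the highest root `θ` -/
  θ : V
  θ_pos : θ ∈ Pos
  θ_highest : ∀ ν ∈ Δ, θ - ν ∈ AddSubmonoid.closure Pos

namespace RootSystemCtx

variable {V : Type*} [AddCommGroup V] [Module ℚ V] (ctx : RootSystemCtx V)

/-- the simple roots `Π`: indecomposable positive roots -/
def simple : Set V :=
  {α | α ∈ ctx.Pos ∧ ¬∃ β ∈ ctx.Pos, ∃ γ ∈ ctx.Pos, α = β + γ}

/-- `ρ`, the half-sum of all positive roots -/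
noncomputable def ρ : V :=
  (1 / 2 : ℚ) • ∑ α ∈ (ctx.Δ_finite.subset ctx.pos_subset).toFinset, α

/-- the coroot `μ∨ = 2μ/(μ,μ)` -/
noncomputable def coroot (μ : V) : V := (2 / ctx.B μ μ) • μ

/-- `Δ⁺_l`, the long positive roots (roots of the same length as `θ`) -/
def PosLong : Set V := {μ | μ ∈ ctx.Pos ∧ ctx.B μ μ = ctx.B ctx.θ ctx.θ}

/-- `Π_l`, the long simple roots -/
def SimpleLong : Set V := {μ | μ ∈ ctx.simple ∧ ctx.B μ μ = ctx.B ctx.θ ctx.θ}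

/-- the dominance order `μ ≼ ν` on the root lattice: `ν - μ` is a nonnegative
integer combination of positive roots -/
def le (μ ν : V) : Prop := ν - μ ∈ AddSubmonoid.closure ctx.Pos

/-- a (combinatorial) abelian ideal of `Δ⁺` -/
def IsAbelianIdeal (I : Set V) : Prop :=
  I ⊆ ctx.Pos ∧ (∀ μ ∈ I, ∀ ν ∈ I, μ + ν ∉ ctx.Δ) ∧
    ∀ γ ∈ I, ∀ ν ∈ ctx.Pos, γ + ν ∈ ctx.Δ → γ + ν ∈ I

/-- `γ` is a generator of the ideal `I` -/
def IsGenerator (I : Set V) (γ : V) : Prop := γ ∈ I ∧ ∀ α ∈ ctx.Pos, γ - α ∉ I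

/-! ### The affine picture: `V̂ = V ⊕ ℚδ ⊕ ℚλ`, modelled as `V × ℚ × ℚ`,
with `δ = (0,1,0)` and `λ = (0,0,1)`. -/

/-- the embedding of `V` into `V̂` -/
def emb (_ctx : RootSystemCtx V) (v : V) : V × ℚ × ℚ := (v, 0, 0)

/-- the imaginary root `δ` -/
def δhat (_ctx : RootSystemCtx V) : V × ℚ × ℚ := (0, 1, 0)

/-- the affine simple root `α₀ = δ - θ` -/
def alpha0 : V × ℚ × ℚ := (-ctx.θ, 1, 0)

/-- the extension of the inner product to `V̂`, with
`(δ,V)=(λ,V)=(δ,δ)=(λ,λ)=0` and `(δ,λ)=1` -/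
noncomputable def Bhat : (V × ℚ × ℚ) →ₗ[ℚ] (V × ℚ × ℚ) →ₗ[ℚ] ℚ :=
  LinearMap.mk₂ ℚ (fun x y => ctx.B x.1 y.1 + x.2.1 * y.2.2 + x.2.2 * y.2.1)
    (fun x x' y => by
      simp only [Prod.fst_add, Prod.snd_add, map_add, LinearMap.add_apply]; ring)
    (fun c x y => by
      simp only [Prod.smul_fst, Prod.smul_snd, map_smul, LinearMap.smul_apply,
        smul_eq_mul]; ring)
    (fun x y y' => by
      simp only [Prod.fst_add, Prod.snd_add, map_add]; ring)
    (fun c x y => by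
      simp only [Prod.smul_fst, Prod.smul_snd, map_smul, smul_eq_mul]; ring)

/-- the set `Δ̂` of affine real roots -/
def Δhat : Set (V × ℚ × ℚ) := {x | ∃ α ∈ ctx.Δ, ∃ k : ℤ, x = (α, (k : ℚ), 0)}

/-- the set `Δ̂⁺` of positive affine roots -/
def PosHat : Set (V × ℚ × ℚ) :=
  {x | ∃ α ∈ ctx.Pos, x = (α, 0, 0)} ∪
    {x | ∃ α ∈ ctx.Δ, ∃ k : ℤ, 1 ≤ k ∧ x = (α, (k : ℚ), 0)}

/-- the set `Π̂ = Π ∪ {α₀}` of affine simple roots -/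
def SimpleHat : Set (V × ℚ × ℚ) :=
  {x | ∃ α ∈ ctx.simple, x = (α, (0 : ℚ), (0 : ℚ))} ∪ {ctx.alpha0}

/-- the reflection `s_β : x ↦ x − (2(x,β)/(β,β))·β` in `V̂` -/
noncomputable def refl (β : V × ℚ × ℚ) : (V × ℚ × ℚ) ≃ₗ[ℚ] (V × ℚ × ℚ) :=
  if h : ctx.Bhat β β = 0 then LinearEquiv.refl ℚ _
  else
    Module.reflection (x := β) (f := (2 / ctx.Bhat β β) • ctx.Bhat β)
      (by simp only [LinearMap.smul_apply, smul_eq_mul]; field_simp)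

/-- the affine Weyl group `Ŵ`, generated by the reflections `s_β`, `β ∈ Δ̂` -/
def What : Subgroup ((V × ℚ × ℚ) ≃ₗ[ℚ] (V × ℚ × ℚ)) :=
  Subgroup.closure {g | ∃ β ∈ ctx.Δhat, g = ctx.refl β}

/-- the finite Weyl group `W`, generated by the reflections `s_α`, `α ∈ Δ`
(identified with a subgroup of `Ŵ`) -/
def Wfin : Subgroup ((V × ℚ × ℚ) ≃ₗ[ℚ] (V × ℚ × ℚ)) :=
  Subgroup.closure {g | ∃ α ∈ ctx.Δ, g = ctx.refl (α, (0 : ℚ), (0 : ℚ))}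

/-- `N̂(w) = {β ∈ Δ̂⁺ : w(β) ∈ −Δ̂⁺}` -/
def Nhat (w : (V × ℚ × ℚ) ≃ₗ[ℚ] (V × ℚ × ℚ)) : Set (V × ℚ × ℚ) :=
  {β | β ∈ ctx.PosHat ∧ -(w β) ∈ ctx.PosHat}

/-- a minuscule element of `Ŵ`: every element of `N̂(w)` has the form `δ - γ`
with `γ ∈ Δ⁺` -/
def IsMinuscule (w : (V × ℚ × ℚ) ≃ₗ[ℚ] (V × ℚ × ℚ)) : Prop :=
  w ∈ ctx.What ∧ ∀ β ∈ ctx.Nhat w, ∃ γ ∈ ctx.Pos, β = ctx.δhat - ctx.emb γ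

/-- the abelian ideal `I_w` corresponding to a minuscule element `w` -/
def idealOf (w : (V × ℚ × ℚ) ≃ₗ[ℚ] (V × ℚ × ℚ)) : Set V :=
  {γ | γ ∈ ctx.Pos ∧ ctx.δhat - ctx.emb γ ∈ ctx.Nhat w}

/-- the ideal `I` has rootlet `τ(I) = μ`, i.e. `I = I_w` for some minuscule `w`
with `w(α₀) + δ = μ` -/
def HasRootlet (I : Set V) (μ : V) : Prop :=
  ∃ w, ctx.IsMinuscule w ∧ ctx.idealOf w = I ∧ w ctx.alpha0 + ctx.δhat = ctx.emb μ

/-- `Ab_μ`, the set of nonempty abelian ideals with rootlet `μ` -/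
def AbFiber (μ : V) : Set (Set V) := {I | I.Nonempty ∧ ctx.HasRootlet I μ}

/-- `N(u) = {γ ∈ Δ⁺ : u(γ) ∈ −Δ⁺}` for `u` in the finite Weyl group -/
def Nfin (w : (V × ℚ × ℚ) ≃ₗ[ℚ] (V × ℚ × ℚ)) : Set V :=
  {γ | γ ∈ ctx.Pos ∧ -(w (ctx.emb γ)) ∈ ctx.PosHat}

/-- the length `l(u) = #N(u)` of an element of the finite Weyl group -/
noncomputable def lenFin (w : (V × ℚ × ℚ) ≃ₗ[ℚ] (V × ℚ × ℚ)) : ℕ :=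
  (ctx.Nfin w).ncard

end RootSystemCtx

namespace RootSystemCtx

variable {V : Type*} [AddCommGroup V] [Module ℚ V] (ctx : RootSystemCtx V)

/-! ### The finite root system -/

theorem B_self_pos {α : V} (h : α ∈ ctx.Δ) : 0 < ctx.B α α :=
  ctx.B_posdef α fun h0 => ctx.zero_notMem_Δ (h0 ▸ h)

/-- Two roots at an obtuse angle that are not opposite have a root as their sum. -/
theorem add_mem_of_neg {α β : V} (hα : α ∈ ctx.Δ) (hβ : β ∈ ctx.Δ) (h : ctx.B α β < 0)
    (hne : α + β ≠ 0) : α + β ∈ ctx.Δ := by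
  obtain ⟨n, hn⟩ := ctx.crystallographic α hα β hβ
  obtain ⟨m, hm⟩ := ctx.crystallographic β hβ α hα
  have ha := ctx.B_self_pos hα
  have hb := ctx.B_self_pos hβ
  have hs := ctx.B_symm α β
  have hn' : 2 * ctx.B α β = n * ctx.B β β := by rw [← hn]; field_simp
  have hm' : 2 * ctx.B α β = m * ctx.B α α := by rw [hs, ← hm]; field_simp
  have hn0 : n < 0 := by
    have : (n : ℚ) < 0 := by by_contra hc; push Not at hc; nlinarith
    exact_mod_cast this
  have hm0 : m < 0 := by
    have : (m : ℚ) < 0 := by by_contra hc; push Not at hc; nlinarith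
    exact_mod_cast this
  have r1 := ctx.reflect_mem α hα β hβ
  rw [hm] at r1
  have r2 := ctx.reflect_mem β hβ α hα
  rw [hn] at r2
  by_cases h1 : n = -1
  · subst h1; simpa using r2
  by_cases h2 : m = -1
  · subst h2; simpa [add_comm] using r1
  exfalso
  have hn2 : (n : ℚ) ≤ -2 := by exact_mod_cast (show n ≤ -2 by omega)
  have hm2 : (m : ℚ) ≤ -2 := by exact_mod_cast (show m ≤ -2 by omega)
  have hz : ctx.B β β • α - ctx.B α β • β = 0 := by
    by_contra hc
    have := ctx.B_posdef _ hc
    simp only [map_sub, map_smul, LinearMap.sub_apply, LinearMap.smul_apply, smul_eq_mul,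
      ← hs] at this
    have e : ctx.B α β * ctx.B α β * 4 = n * m * (ctx.B α α * ctx.B β β) := by
      linear_combination (2 * ctx.B α β) * hn' + n * ctx.B β β * hm'
    have h4 : (4 : ℚ) ≤ n * m := by nlinarith
    have h5 : 0 < ctx.B α α * ctx.B β β := mul_pos ha hb
    nlinarith [mul_le_mul_of_nonneg_right h4 h5.le]
  have hαβ : α = (ctx.B α β / ctx.B β β) • β := by
    rw [div_eq_inv_mul, mul_smul, ← sub_eq_zero.mp hz, smul_smul, inv_mul_cancel₀ hb.ne', one_smul]
  rcases ctx.reduced β hβ _ (hαβ ▸ hα) with hc | hc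
  · have : ctx.B α β / ctx.B β β < 0 := div_neg_of_neg_of_pos h hb
    linarith
  · rw [hc] at hαβ
    exact hne (by rw [hαβ]; simp)

theorem multiset_eq_zero_of_sum_eq_zero (s : Multiset V) (hs : ∀ a ∈ s, a ∈ ctx.Pos)
    (h0 : s.sum = 0) : s = 0 := by
  induction hn : s.card using Nat.strong_induction_on generalizing s with
  | _ n ih =>
    subst hn
    rcases Multiset.empty_or_exists_mem s with h | ⟨a, ha⟩
    · exact h
    exfalso
    obtain ⟨t, rfl⟩ := Multiset.exists_cons_of_mem ha
    have hap := hs a ha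
    have haa := ctx.B_self_pos (ctx.pos_subset hap)
    have hsum : ctx.B a t.sum < 0 := by
      have : t.sum = -a := by
        rw [Multiset.sum_cons] at h0
        exact (neg_eq_of_add_eq_zero_right h0).symm
      rw [this, map_neg]; linarith
    obtain ⟨b, hb, hab⟩ : ∃ b ∈ t, ctx.B a b < 0 := by
      by_contra hc
      push Not at hc
      have : 0 ≤ (t.map (ctx.B a)).sum := by
        apply Multiset.sum_nonneg
        simpa using hc
      rw [← map_multiset_sum] at this
      linarith
    obtain ⟨r, rfl⟩ := Multiset.exists_cons_of_mem hb
    have hbp := hs b (Multiset.mem_cons_of_mem hb)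
    have hne : a + b ≠ 0 := fun h => ctx.pos_not_neg a hap (by
      rwa [neg_eq_of_add_eq_zero_right h])
    have hmem := ctx.add_pos_mem a hap b hbp
      (ctx.add_mem_of_neg (ctx.pos_subset hap) (ctx.pos_subset hbp) hab hne)
    have := ih _ (by simp) ((a + b) ::ₘ r) (by
      intro x hx
      rcases Multiset.mem_cons.mp hx with rfl | hx
      · exact hmem
      · exact hs x (by simp [hx])) (by
      rw [← h0]; simp [add_assoc]) rfl
    simp at this

/-- The cone of nonnegative combinations of positive roots is pointed. -/
theorem eq_zero_of_mem_closure {x : V} (h : x ∈ AddSubmonoid.closure ctx.Pos)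
    (h' : -x ∈ AddSubmonoid.closure ctx.Pos) : x = 0 := by
  obtain ⟨s, hs, rfl⟩ := AddSubmonoid.exists_multiset_of_mem_closure h
  obtain ⟨t, ht, hts⟩ := AddSubmonoid.exists_multiset_of_mem_closure h'
  have := ctx.multiset_eq_zero_of_sum_eq_zero (s + t)
    (fun a ha => (Multiset.mem_add.mp ha).elim (hs a) (ht a)) (by simp [hts])
  have : s = 0 := (add_eq_zero.mp this).1
  simp [this]

theorem pos_mem_closure {x : V} (h : x ∈ ctx.Pos) : x ∈ AddSubmonoid.closure ctx.Pos :=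
  AddSubmonoid.subset_closure h

theorem ne_zero_of_pos {x : V} (h : x ∈ ctx.Pos) : x ≠ 0 := fun h0 =>
  ctx.zero_notMem_Δ (h0 ▸ ctx.pos_subset h)

theorem neg_pos_notMem_closure {x : V} (h : -x ∈ ctx.Pos) :
    x ∉ AddSubmonoid.closure ctx.Pos := fun hc =>
  ctx.ne_zero_of_pos h (by simp [ctx.eq_zero_of_mem_closure hc (ctx.pos_mem_closure h)])

theorem pos_of_mem_closure {x : V} (hx : x ∈ ctx.Δ) (h : x ∈ AddSubmonoid.closure ctx.Pos) :
    x ∈ ctx.Pos :=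
  (ctx.mem_pos_or_neg_pos x hx).resolve_right fun hc => ctx.neg_pos_notMem_closure hc h

theorem neg_pos_iff {x : V} (hx : x ∈ ctx.Δ) : -x ∈ ctx.Pos ↔ x ∉ ctx.Pos :=
  ⟨fun h h' => ctx.pos_not_neg x h' h, fun h => (ctx.mem_pos_or_neg_pos x hx).resolve_left h⟩

theorem θ_mem : ctx.θ ∈ ctx.Δ := ctx.pos_subset ctx.θ_pos

/-- the integer `(x, α∨)` -/
noncomputable def pair (α : V) : V →ₗ[ℚ] ℚ := (2 / ctx.B α α) • ctx.B α

theorem pair_apply (α x : V) : ctx.pair α x = 2 * ctx.B x α / ctx.B α α := by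
  simp [pair, ctx.B_symm α x]; ring

theorem pair_self {α : V} (h : α ∈ ctx.Δ) : ctx.pair α α = 2 := by
  have := (ctx.B_self_pos h).ne'
  rw [pair_apply]; field_simp

theorem pair_int {α x : V} (h : α ∈ ctx.Δ) (hx : x ∈ ctx.Δ) :
    ∃ n : ℤ, ctx.pair α x = n := by
  simpa [pair_apply] using ctx.crystallographic x hx α h

/-- the reflection `s_α` of `V` -/
noncomputable def sV {α : V} (h : α ∈ ctx.Δ) : V ≃ₗ[ℚ] V := Module.reflection (ctx.pair_self h)

theorem sV_apply {α : V} (h : α ∈ ctx.Δ) (x : V) : ctx.sV h x = x - ctx.pair α x • α :=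
  Module.reflection_apply _ _

theorem sV_mem {α x : V} (h : α ∈ ctx.Δ) (hx : x ∈ ctx.Δ) : ctx.sV h x ∈ ctx.Δ := by
  rw [sV_apply, pair_apply]; exact ctx.reflect_mem α h x hx

theorem sV_sV {α : V} (h : α ∈ ctx.Δ) (x : V) : ctx.sV h (ctx.sV h x) = x :=
  Module.involutive_reflection _ x

theorem sV_mem_iff {α x : V} (h : α ∈ ctx.Δ) : ctx.sV h x ∈ ctx.Δ ↔ x ∈ ctx.Δ :=
  ⟨fun hx => by simpa [sV_sV] using ctx.sV_mem h hx, ctx.sV_mem h⟩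

theorem B_sV {α : V} (h : α ∈ ctx.Δ) (x y : V) :
    ctx.B (ctx.sV h x) (ctx.sV h y) = ctx.B x y := by
  have := (ctx.B_self_pos h).ne'
  simp only [sV_apply, map_sub, map_smul, LinearMap.sub_apply, LinearMap.smul_apply, smul_eq_mul,
    pair_apply, ctx.B_symm α y]
  field_simp
  ring

theorem pair_θ_pos_iff {x : V} : 0 < ctx.pair ctx.θ x ↔ 0 < ctx.B x ctx.θ := by
  have := ctx.B_self_pos ctx.θ_mem
  rw [pair_apply, div_pos_iff_of_pos_right this]
  constructor <;> intro h <;> linarith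

theorem pair_θ_eq_zero_iff {x : V} : ctx.pair ctx.θ x = 0 ↔ ctx.B x ctx.θ = 0 := by
  have := ctx.B_self_pos ctx.θ_mem
  rw [pair_apply, div_eq_zero_iff]
  constructor
  · rintro (h | h) <;> linarith
  · intro h; left; linarith

/-- A positive root is `θ`, or orthogonal to `θ`, or has pairing `1` with `θ∨`. -/
theorem pos_trichotomy {γ : V} (h : γ ∈ ctx.Pos) :
    γ = ctx.θ ∨ ctx.pair ctx.θ γ = 0 ∨ (ctx.pair ctx.θ γ = 1 ∧ ctx.θ - γ ∈ ctx.Pos) := by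
  have hγ := ctx.pos_subset h
  obtain ⟨n, hn⟩ := ctx.pair_int ctx.θ_mem hγ
  have hs := ctx.sV_mem ctx.θ_mem hγ
  rw [sV_apply, hn] at hs
  have hθ := ctx.B_self_pos ctx.θ_mem
  rw [hn]
  have hn0 : 0 ≤ n := by
    by_contra hc
    have hneg : ctx.B γ ctx.θ < 0 := by
      have : ctx.pair ctx.θ γ < 0 := by rw [hn]; exact_mod_cast not_le.mp hc
      rw [pair_apply, div_neg_iff] at this
      rcases this with h | h <;> linarith [h.1, h.2]
    have hne : γ + ctx.θ ≠ 0 := fun h0 => ctx.pos_not_neg γ h (by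
      rw [neg_eq_of_add_eq_zero_right h0]; exact ctx.θ_pos)
    have := ctx.θ_highest _ (ctx.add_mem_of_neg hγ ctx.θ_mem hneg hne)
    rw [sub_add_cancel_right] at this
    exact ctx.neg_pos_notMem_closure (by simpa using h) this
  rcases (by omega : n = 0 ∨ n = 1 ∨ 2 ≤ n) with rfl | rfl | h2
  · simp
  · right; right
    refine ⟨by simp, ctx.pos_of_mem_closure ?_ (ctx.θ_highest γ hγ)⟩
    simpa using ctx.neg_mem_Δ _ hs
  · left
    have h1 := ctx.θ_highest _ (ctx.neg_mem_Δ _ hs)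
    have h3 : γ - ctx.θ ∈ AddSubmonoid.closure ctx.Pos := by
      obtain ⟨k, hk⟩ := Int.eq_ofNat_of_zero_le (by omega : 0 ≤ n - 2)
      have : γ - ctx.θ = (ctx.θ - -(γ - (n : ℚ) • ctx.θ)) + k • ctx.θ := by
        have : (n : ℚ) = k + 2 := by
          have : n = k + 2 := by omega
          rw [this]; push_cast; ring
        rw [this, ← Nat.cast_smul_eq_nsmul ℚ]; module
      rw [this]
      exact add_mem h1 (nsmul_mem (ctx.pos_mem_closure ctx.θ_pos) k)
    have h4 := ctx.θ_highest γ hγ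
    exact sub_eq_zero.mp (ctx.eq_zero_of_mem_closure h3 (by simpa using h4))

theorem pair_θ_nonneg {γ : V} (h : γ ∈ ctx.Pos) : 0 ≤ ctx.pair ctx.θ γ := by
  rcases ctx.pos_trichotomy h with rfl | h | h
  · rw [ctx.pair_self ctx.θ_mem]; norm_num
  · rw [h]
  · rw [h.1]; norm_num

theorem B_θ_nonneg {γ : V} (h : γ ∈ ctx.Pos) : 0 ≤ ctx.B γ ctx.θ := by
  rcases (ctx.pair_θ_nonneg h).lt_or_eq with h | h
  · exact (ctx.pair_θ_pos_iff.mp h).le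
  · exact (ctx.pair_θ_eq_zero_iff.mp h.symm).ge

/-! ### The level-zero action of the affine Weyl group -/

/-- `g` acts on level-zero vectors by `x + kδ ↦ u x + (k + f x)δ`, where `u` is an isometry of the
root system and `f` is integral on the roots. -/
structure AffAct (g : (V × ℚ × ℚ) ≃ₗ[ℚ] (V × ℚ × ℚ)) (u : V ≃ₗ[ℚ] V) (f : V →ₗ[ℚ] ℚ) : Prop where
  act : ∀ x k, g (x, k, 0) = (u x, k + f x, 0)
  mem_iff : ∀ x, u x ∈ ctx.Δ ↔ x ∈ ctx.Δ
  isom : ∀ x y, ctx.B (u x) (u y) = ctx.B x y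
  int : ∀ α ∈ ctx.Δ, ∃ n : ℤ, f α = n

variable {ctx}

theorem AffAct.one : ctx.AffAct 1 (LinearEquiv.refl ℚ V) 0 where
  act x k := by simp
  mem_iff x := by simp
  isom x y := by simp
  int α _ := ⟨0, by simp⟩

theorem AffAct.mul {g h : (V × ℚ × ℚ) ≃ₗ[ℚ] (V × ℚ × ℚ)} {u v : V ≃ₗ[ℚ] V} {e f : V →ₗ[ℚ] ℚ}
    (hg : ctx.AffAct g u e) (hh : ctx.AffAct h v f) :
    ctx.AffAct (g * h) (v.trans u) (f + e ∘ₗ v.toLinearMap) where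
  act x k := by simp [LinearEquiv.mul_apply, hh.act, hg.act, add_assoc]
  mem_iff x := by simp [hg.mem_iff, hh.mem_iff]
  isom x y := by simp [hg.isom, hh.isom]
  int α hα := by
    obtain ⟨n, hn⟩ := hh.int α hα
    obtain ⟨m, hm⟩ := hg.int _ ((hh.mem_iff α).mpr hα)
    exact ⟨n + m, by simp [hn, hm]⟩

theorem AffAct.inv {g : (V × ℚ × ℚ) ≃ₗ[ℚ] (V × ℚ × ℚ)} {u : V ≃ₗ[ℚ] V} {f : V →ₗ[ℚ] ℚ}
    (hg : ctx.AffAct g u f) : ctx.AffAct g⁻¹ u.symm (-(f ∘ₗ u.symm.toLinearMap)) where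
  act x k := by
    have : g (u.symm x, k - f (u.symm x), 0) = (x, k, 0) := by simp [hg.act]
    rw [← this, ← LinearEquiv.mul_apply, inv_mul_cancel]
    simp [sub_eq_add_neg]
  mem_iff x := by rw [← hg.mem_iff]; simp
  isom x y := by rw [← hg.isom]; simp
  int α hα := by
    obtain ⟨n, hn⟩ := hg.int (u.symm α) (by rw [← hg.mem_iff]; simpa)
    exact ⟨-n, by simp [hn]⟩

variable (ctx)

theorem refl_apply {α : V} (h : α ∈ ctx.Δ) (m : ℚ) (x : V) (k : ℚ) :
    ctx.refl (α, m, 0) (x, k, 0) = (x - ctx.pair α x • α, k - ctx.pair α x * m, 0) := by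
  have h0 := (ctx.B_self_pos h).ne'
  rw [refl, dif_neg (by simpa [Bhat] using h0), Module.reflection_apply]
  simp [Bhat, pair]

theorem refl_finite_apply {α : V} (h : α ∈ ctx.Δ) (x : V) (k l : ℚ) :
    ctx.refl (α, 0, 0) (x, k, l) = (ctx.sV h x, k, l) := by
  have h0 := (ctx.B_self_pos h).ne'
  rw [refl, dif_neg (by simpa [Bhat] using h0), Module.reflection_apply]
  simp [Bhat, pair, sV_apply]

theorem affAct_refl {α : V} (h : α ∈ ctx.Δ) (m : ℤ) :
    ctx.AffAct (ctx.refl (α, (m : ℚ), 0)) (ctx.sV h) (-(m : ℚ) • ctx.pair α) where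
  act x k := by
    rw [ctx.refl_apply h, sV_apply]
    simp; ring
  mem_iff x := ctx.sV_mem_iff h
  isom x y := ctx.B_sV h x y
  int β hβ := by
    obtain ⟨n, hn⟩ := ctx.pair_int h hβ
    exact ⟨-m * n, by simp [hn]⟩

theorem exists_affAct {g : (V × ℚ × ℚ) ≃ₗ[ℚ] (V × ℚ × ℚ)} (hg : g ∈ ctx.What) :
    ∃ u f, ctx.AffAct g u f := by
  induction hg using Subgroup.closure_induction with
  | mem x hx =>
    obtain ⟨_, ⟨α, hα, k, rfl⟩, rfl⟩ := hx
    exact ⟨_, _, ctx.affAct_refl hα k⟩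
  | one => exact ⟨_, _, AffAct.one⟩
  | mul x y _ _ hx hy =>
    obtain ⟨_, _, hx⟩ := hx
    obtain ⟨_, _, hy⟩ := hy
    exact ⟨_, _, hx.mul hy⟩
  | inv x _ hx =>
    obtain ⟨_, _, hx⟩ := hx
    exact ⟨_, _, hx.inv⟩

theorem Wfin_le_What : ctx.Wfin ≤ ctx.What := by
  refine Subgroup.closure_mono ?_
  rintro _ ⟨α, hα, rfl⟩
  exact ⟨_, ⟨α, hα, 0, by simp⟩, rfl⟩

theorem refl_alpha0_mem : ctx.refl ctx.alpha0 ∈ ctx.What :=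
  Subgroup.subset_closure ⟨_, ⟨-ctx.θ, ctx.neg_mem_Δ _ ctx.θ_mem, 1, by simp [alpha0]⟩, rfl⟩

theorem exists_affAct_Wfin {g : (V × ℚ × ℚ) ≃ₗ[ℚ] (V × ℚ × ℚ)} (hg : g ∈ ctx.Wfin) :
    ∃ u, ctx.AffAct g u 0 := by
  induction hg using Subgroup.closure_induction with
  | mem x hx =>
    obtain ⟨α, hα, rfl⟩ := hx
    exact ⟨_, by simpa using ctx.affAct_refl hα 0⟩
  | one => exact ⟨_, AffAct.one⟩
  | mul x y _ _ hx hy =>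
    obtain ⟨_, hx⟩ := hx
    obtain ⟨_, hy⟩ := hy
    exact ⟨_, by simpa using hx.mul hy⟩
  | inv x _ hx =>
    obtain ⟨_, hx⟩ := hx
    exact ⟨_, by simpa using hx.inv⟩

theorem refl_alpha0_apply (x : V) (k : ℚ) :
    ctx.refl ctx.alpha0 (x, k, 0) = (ctx.sV ctx.θ_mem x, k + ctx.pair ctx.θ x, 0) := by
  rw [alpha0, ctx.refl_apply (ctx.neg_mem_Δ _ ctx.θ_mem), sV_apply]
  have : ctx.pair (-ctx.θ) x = - ctx.pair ctx.θ x := by simp [pair]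
  rw [this]
  simp

theorem mem_PosHat {x : V} {k : ℤ} :
    (x, (k : ℚ), (0 : ℚ)) ∈ ctx.PosHat ↔ x ∈ ctx.Δ ∧ (0 < k ∨ k = 0 ∧ x ∈ ctx.Pos) := by
  constructor
  · rintro (⟨α, hα, h⟩ | ⟨α, hα, n, hn, h⟩)
    · simp only [Prod.mk.injEq, Int.cast_eq_zero, and_true] at h
      obtain ⟨rfl, rfl⟩ := h
      exact ⟨ctx.pos_subset hα, by simp [hα]⟩
    · simp only [Prod.mk.injEq, Int.cast_inj, and_true] at h
      obtain ⟨rfl, rfl⟩ := h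
      exact ⟨hα, by omega⟩
  · rintro ⟨hx, hk | ⟨rfl, hk⟩⟩
    · exact Or.inr ⟨x, hx, k, by omega, rfl⟩
    · exact Or.inl ⟨x, hk, by simp⟩

theorem mem_PosHat_zero {x : V} : (x, (0 : ℚ), (0 : ℚ)) ∈ ctx.PosHat ↔ x ∈ ctx.Pos := by
  have := ctx.mem_PosHat (x := x) (k := 0)
  simp only [Int.cast_zero] at this
  rw [this]
  simpa using fun h => ctx.pos_subset h

theorem exists_of_mem_PosHat {β : V × ℚ × ℚ} (h : β ∈ ctx.PosHat) :
    ∃ x ∈ ctx.Δ, ∃ k : ℤ, β = (x, (k : ℚ), 0) := by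
  rcases h with ⟨α, hα, rfl⟩ | ⟨α, hα, n, hn, rfl⟩
  · exact ⟨α, ctx.pos_subset hα, 0, by simp⟩
  · exact ⟨α, hα, n, rfl⟩

theorem mem_PosHat_or_neg {x : V} (hx : x ∈ ctx.Δ) (k : ℤ) :
    (x, (k : ℚ), (0 : ℚ)) ∈ ctx.PosHat ∨ -(x, (k : ℚ), (0 : ℚ)) ∈ ctx.PosHat := by
  have e : -(x, (k : ℚ), (0 : ℚ)) = (-x, ((-k : ℤ) : ℚ), (0 : ℚ)) := by simp
  rw [e, mem_PosHat, mem_PosHat]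
  have := ctx.neg_mem_Δ x hx
  rcases lt_trichotomy k 0 with h | rfl | h
  · right; exact ⟨this, by omega⟩
  · rcases ctx.mem_pos_or_neg_pos x hx with h | h
    · left; simp [h, hx]
    · right; simp [h, this]
  · left; exact ⟨hx, by omega⟩

theorem AffAct.mem_PosHat_or_neg {ctx : RootSystemCtx V}
    {g : (V × ℚ × ℚ) ≃ₗ[ℚ] (V × ℚ × ℚ)} {u : V ≃ₗ[ℚ] V} {f : V →ₗ[ℚ] ℚ} (hg : ctx.AffAct g u f)
    {x : V} (hx : x ∈ ctx.Δ) (k : ℤ) :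
    g (x, (k : ℚ), 0) ∈ ctx.PosHat ∨ -g (x, (k : ℚ), 0) ∈ ctx.PosHat := by
  obtain ⟨n, hn⟩ := hg.int x hx
  have := ctx.mem_PosHat_or_neg ((hg.mem_iff x).mpr hx) (k + n)
  rw [hg.act, hn]
  simpa using this

theorem closure_PosHat {β : V × ℚ × ℚ} (h : β ∈ AddSubmonoid.closure ctx.PosHat) :
    0 ≤ β.2.1 ∧ (β.2.1 = 0 → β.1 ∈ AddSubmonoid.closure ctx.Pos) := by
  induction h using AddSubmonoid.closure_induction with
  | mem x hx =>
    rcases hx with ⟨α, hα, rfl⟩ | ⟨α, hα, n, hn, rfl⟩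
    · exact ⟨le_rfl, fun _ => ctx.pos_mem_closure hα⟩
    · have : (1 : ℚ) ≤ n := by exact_mod_cast hn
      exact ⟨by simp; linarith, fun h => by simp at h; simp [h] at this; linarith⟩
  | zero => simp
  | add x y _ _ hx hy =>
    refine ⟨add_nonneg hx.1 hy.1, fun h => ?_⟩
    have h' : x.2.1 + y.2.1 = 0 := h
    exact add_mem (hx.2 (by linarith [hx.1, hy.1])) (hy.2 (by linarith [hx.1, hy.1]))

theorem neg_notMem_closure_PosHat {β : V × ℚ × ℚ} (h : -β ∈ ctx.PosHat) :
    β ∉ AddSubmonoid.closure ctx.PosHat := by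
  intro hc
  have h1 := ctx.closure_PosHat hc
  rcases h with ⟨α, hα, h⟩ | ⟨α, hα, n, hn, h⟩
  · obtain rfl : β = (-α, 0, 0) := by rw [← neg_neg β, h]; simp
    exact ctx.neg_pos_notMem_closure (by simpa using hα) (h1.2 rfl)
  · obtain rfl : β = (-α, -(n : ℚ), 0) := by rw [← neg_neg β, h]; simp
    have : (1 : ℚ) ≤ n := by exact_mod_cast hn
    have := h1.1
    simp at this
    linarith

theorem neg_notMem_PosHat {β : V × ℚ × ℚ} (h : β ∈ ctx.PosHat) : -β ∉ ctx.PosHat := fun hc =>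
  ctx.neg_notMem_closure_PosHat hc (AddSubmonoid.subset_closure h)

/-- `s₀` permutes the positive affine roots other than `α₀`. -/
theorem refl_alpha0_mem_PosHat {β : V × ℚ × ℚ} (h : β ∈ ctx.PosHat) (hne : β ≠ ctx.alpha0) :
    ctx.refl ctx.alpha0 β ∈ ctx.PosHat := by
  obtain ⟨x, hx, k, rfl⟩ := ctx.exists_of_mem_PosHat h
  obtain ⟨n, hn⟩ := ctx.pair_int ctx.θ_mem hx
  rw [refl_alpha0_apply, hn, ← Int.cast_add, mem_PosHat]
  refine ⟨ctx.sV_mem _ hx, ?_⟩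
  rw [mem_PosHat] at h
  rcases ctx.mem_pos_or_neg_pos x hx with hp | hp
  · have h0 := ctx.pair_θ_nonneg hp
    rw [hn] at h0
    have h0 : 0 ≤ n := by exact_mod_cast h0
    rcases h0.lt_or_eq with h0 | rfl
    · left; rcases h.2 with h | h <;> omega
    · rcases h.2 with h | h
      · left; omega
      · right
        refine ⟨by omega, ?_⟩
        rw [sV_apply, hn]; simpa using hp
  · have hk : 0 < k := h.2.resolve_right fun h' => ctx.pos_not_neg x h'.2 hp
    have hn' : ctx.pair ctx.θ (-x) = -n := by simp [hn]
    rcases ctx.pos_trichotomy hp with he | he | ⟨he, hp'⟩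
    · obtain rfl : x = -ctx.θ := by rw [← he]; simp
      have : n = -2 := by
        have := ctx.pair_self ctx.θ_mem
        simp [this] at hn'
        exact_mod_cast (show (n : ℚ) = -2 by linarith)
      have hk1 : k ≠ 1 := by rintro rfl; simp [alpha0] at hne
      rcases (by omega : 2 < k ∨ k = 2) with h | rfl
      · left; omega
      · right
        refine ⟨by omega, ?_⟩
        rw [sV_apply, hn, this]
        convert ctx.θ_pos using 1
        push_cast; module
    · have : n = 0 := by
        rw [he] at hn'; exact_mod_cast (show (n : ℚ) = 0 by linarith)
      left; omega
    · have : n = -1 := by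
        rw [he] at hn'; exact_mod_cast (show (n : ℚ) = -1 by linarith)
      rcases (by omega : 1 < k ∨ k = 1) with h | rfl
      · left; omega
      · right
        refine ⟨by omega, ?_⟩
        rw [sV_apply, hn, this]
        convert hp' using 1
        push_cast; module

theorem refl_alpha0_alpha0 : ctx.refl ctx.alpha0 ctx.alpha0 = -ctx.alpha0 := by
  refine (ctx.refl_alpha0_apply (-ctx.θ) 1).trans ?_
  rw [alpha0, sV_apply, map_neg, ctx.pair_self ctx.θ_mem]
  simp only [Prod.neg_mk, Prod.mk.injEq, neg_zero, and_true]
  constructor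
  · module
  · norm_num

theorem refl_alpha0_involutive (x : V) (k : ℚ) :
    ctx.refl ctx.alpha0 (ctx.refl ctx.alpha0 (x, k, 0)) = (x, k, 0) := by
  rw [refl_alpha0_apply, refl_alpha0_apply, sV_sV, sV_apply]
  simp [ctx.pair_self ctx.θ_mem]
  ring

/-! ### Sums over roots -/

open Classical in
theorem sum_pos_eq_half_sum (g : V → ℚ) (hg : ∀ η ∈ ctx.Δ, g (-η) = g η) :
    ∑ γ ∈ (ctx.Δ_finite.subset ctx.pos_subset).toFinset, g γ =
      (1 / 2) * ∑ η ∈ ctx.Δ_finite.toFinset, g η := by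
  have h1 : (ctx.Δ_finite.subset ctx.pos_subset).toFinset =
      ctx.Δ_finite.toFinset.filter (· ∈ ctx.Pos) := by
    ext x; simpa using fun h => ctx.pos_subset h
  have h2 : ∑ γ ∈ ctx.Δ_finite.toFinset.filter (· ∈ ctx.Pos), g γ =
      ∑ γ ∈ ctx.Δ_finite.toFinset.filter (· ∉ ctx.Pos), g γ := by
    refine Finset.sum_nbij' (fun x => -x) (fun x => -x) ?_ ?_ ?_ ?_ ?_
    · intro x hx
      simp only [Finset.mem_filter, Set.Finite.mem_toFinset] at hx ⊢
      exact ⟨ctx.neg_mem_Δ _ hx.1, ctx.pos_not_neg x hx.2⟩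
    · intro x hx
      simp only [Finset.mem_filter, Set.Finite.mem_toFinset] at hx ⊢
      exact ⟨ctx.neg_mem_Δ _ hx.1, (ctx.neg_pos_iff hx.1).mpr hx.2⟩
    · simp
    · simp
    · intro x hx
      simp only [Finset.mem_filter, Set.Finite.mem_toFinset] at hx
      exact (hg x hx.1).symm
  rw [← Finset.sum_filter_add_sum_filter_not ctx.Δ_finite.toFinset (· ∈ ctx.Pos) g, ← h2, h1]
  ring

theorem sum_comp_equiv (u : V ≃ₗ[ℚ] V) (hu : ∀ x, u x ∈ ctx.Δ ↔ x ∈ ctx.Δ) {M : Type*}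
    [AddCommMonoid M] (g : V → M) :
    ∑ η ∈ ctx.Δ_finite.toFinset, g (u η) = ∑ η ∈ ctx.Δ_finite.toFinset, g η := by
  refine Finset.sum_nbij' u u.symm ?_ ?_ ?_ ?_ ?_
  · intro x hx; simpa [hu] using hx
  · intro x hx; simpa [← hu (u.symm x)] using hx
  · simp
  · simp
  · simp

/-- Roots are eigenvectors of the Casimir operator `x ↦ ∑ (η, x) η`. -/
theorem exists_casimir {α : V} (hα : α ∈ ctx.Δ) :
    ∃ c : ℚ, ∑ η ∈ ctx.Δ_finite.toFinset, ctx.B η α • η = c • α := by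
  set T := ∑ η ∈ ctx.Δ_finite.toFinset, ctx.B η α • η with hT
  have hα' : ctx.sV hα α = -α := by
    rw [sV_apply, ctx.pair_self hα]; module
  have h1 : ctx.sV hα T = -T := by
    have : ∀ η, ctx.B η α • ctx.sV hα η =
        (fun ξ => -(ctx.B ξ α • ξ)) (ctx.sV hα η) := by
      intro η
      have := ctx.B_sV hα η α
      rw [hα', map_neg] at this
      simp [← this]
    rw [hT, map_sum]
    simp only [map_smul]
    rw [Finset.sum_congr rfl fun η _ => this η,
      ctx.sum_comp_equiv _ (fun x => ctx.sV_mem_iff hα) (fun ξ => -(ctx.B ξ α • ξ)),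
      Finset.sum_neg_distrib]
  rw [sV_apply] at h1
  refine ⟨ctx.pair α T / 2, ?_⟩
  have h2 : (2 : ℚ) • T = ctx.pair α T • α := by
    rw [sub_eq_iff_eq_add] at h1
    rw [two_smul]; nth_rw 1 [h1]; module
  rw [div_eq_inv_mul, mul_smul, ← h2, smul_smul]; norm_num

/-! ### Minuscule elements -/

variable {ctx}

theorem affAct_rootlet {w : (V × ℚ × ℚ) ≃ₗ[ℚ] (V × ℚ × ℚ)} {u : V ≃ₗ[ℚ] V} {f : V →ₗ[ℚ] ℚ}
    (ha : ctx.AffAct w u f) {μ : V} (h : w ctx.alpha0 + ctx.δhat = ctx.emb μ) :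
    u ctx.θ = -μ ∧ f ctx.θ = 2 := by
  rw [alpha0, ha.act] at h
  simp only [map_neg, δhat, emb, Prod.mk_add_mk, Prod.mk.injEq, add_zero] at h
  exact ⟨by rw [← h.1, neg_neg], by linarith [h.2.1]⟩

theorem neg_mem_PosHat {γ : V} (hγ : γ ∈ ctx.Pos) {k : ℤ} (hk : 0 < k) :
    (-γ, (k : ℚ), (0 : ℚ)) ∈ ctx.PosHat :=
  ctx.mem_PosHat.mpr ⟨ctx.neg_mem_Δ _ (ctx.pos_subset hγ), Or.inl hk⟩

theorem mem_idealOf {w : (V × ℚ × ℚ) ≃ₗ[ℚ] (V × ℚ × ℚ)} {γ : V} (hγ : γ ∈ ctx.Pos) :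
    γ ∈ ctx.idealOf w ↔ -w (-γ, 1, 0) ∈ ctx.PosHat := by
  have := neg_mem_PosHat hγ (k := 1) one_pos
  simp only [Int.cast_one] at this
  have e : ctx.δhat - ctx.emb γ = (-γ, 1, 0) := by simp [δhat, emb]
  change (γ ∈ ctx.Pos ∧ ctx.δhat - ctx.emb γ ∈ ctx.PosHat ∧
    -w (ctx.δhat - ctx.emb γ) ∈ ctx.PosHat) ↔ _
  rw [e]
  exact ⟨fun h => h.2.2, fun h => ⟨hγ, this, h⟩⟩

theorem IsMinuscule.snd_eq_one {w : (V × ℚ × ℚ) ≃ₗ[ℚ] (V × ℚ × ℚ)} (hw : ctx.IsMinuscule w)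
    {β : V × ℚ × ℚ} (h1 : β ∈ ctx.PosHat) (h2 : -w β ∈ ctx.PosHat) : β.2.1 = 1 := by
  obtain ⟨γ, _, rfl⟩ := hw.2 β ⟨h1, h2⟩
  simp [δhat, emb]

theorem IsMinuscule.apply_pos {w : (V × ℚ × ℚ) ≃ₗ[ℚ] (V × ℚ × ℚ)} (hw : ctx.IsMinuscule w)
    {γ : V} (hγ : γ ∈ ctx.Pos) : w (γ, 0, 0) ∈ ctx.PosHat := by
  obtain ⟨u, f, ha⟩ := ctx.exists_affAct hw.1
  have := ha.mem_PosHat_or_neg (ctx.pos_subset hγ) 0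
  simp only [Int.cast_zero] at this
  refine this.resolve_right fun h => ?_
  simpa using hw.snd_eq_one (ctx.mem_PosHat_zero.mpr hγ) h

open Classical in
theorem IsMinuscule.indicator_eq {w : (V × ℚ × ℚ) ≃ₗ[ℚ] (V × ℚ × ℚ)} (hw : ctx.IsMinuscule w)
    {u : V ≃ₗ[ℚ] V} {f : V →ₗ[ℚ] ℚ} (ha : ctx.AffAct w u f) {γ : V} (hγ : γ ∈ ctx.Pos) :
    (if γ ∈ ctx.idealOf w then 1 else 0 : ℚ) =
      f γ - 1 / 2 + 1 / 2 * (if u γ ∈ ctx.Pos then 1 else -1) := by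
  have hΔ := ctx.pos_subset hγ
  obtain ⟨n, hn⟩ := ha.int γ hΔ
  have huΔ := (ha.mem_iff γ).mpr hΔ
  have e (m : ℤ) : -w (-γ, (m : ℚ), 0) = (u γ, ((n - m : ℤ) : ℚ), 0) := by
    simp [ha.act, hn]; ring
  have h1 := hw.apply_pos hγ
  rw [ha.act, hn, zero_add, mem_PosHat] at h1
  have h2 : (u γ, ((n - 2 : ℤ) : ℚ), (0 : ℚ)) ∉ ctx.PosHat := fun h => by
    rw [← e] at h
    have := hw.snd_eq_one (neg_mem_PosHat hγ two_pos) h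
    norm_num at this
  have h3 := mem_idealOf (w := w) hγ
  have e1 := e 1
  rw [Int.cast_one] at e1
  rw [e1, mem_PosHat] at h3
  rw [mem_PosHat] at h2
  simp only [huΔ, true_and] at h1 h2 h3
  have hc : n = 0 ∨ n = 1 ∨ n = 2 := by omega
  rw [hn]
  by_cases hu : u γ ∈ ctx.Pos <;> simp only [hu, and_true, and_false, or_false] at h1 h2 h3 <;>
    rcases hc with rfl | rfl | rfl <;> simp_all <;> norm_num

open Classical in
theorem IsMinuscule.sum_eq {w : (V × ℚ × ℚ) ≃ₗ[ℚ] (V × ℚ × ℚ)} (hw : ctx.IsMinuscule w)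
    {μ : V} (h : w ctx.alpha0 + ctx.δhat = ctx.emb μ) {c : ℚ}
    (hc : ∑ η ∈ ctx.Δ_finite.toFinset, ctx.B η ctx.θ • η = c • ctx.θ) :
    ∑ γ ∈ (ctx.Δ_finite.subset ctx.pos_subset).toFinset,
      (if γ ∈ ctx.idealOf w then 1 else 0) * ctx.B γ ctx.θ =
    c - 1 / 2 * ∑ γ ∈ (ctx.Δ_finite.subset ctx.pos_subset).toFinset, ctx.B γ ctx.θ
      - 1 / 4 * ∑ η ∈ ctx.Δ_finite.toFinset, (if η ∈ ctx.Pos then 1 else -1) * ctx.B η μ := by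
  obtain ⟨u, f, ha⟩ := ctx.exists_affAct hw.1
  obtain ⟨hu, hf⟩ := affAct_rootlet ha h
  set ψ : V → ℚ := fun η => (if η ∈ ctx.Pos then 1 else -1) * ctx.B η μ with hψ
  have hψe : ∀ η ∈ ctx.Δ, ψ (-η) = ψ η := by
    intro η hη
    by_cases hp : η ∈ ctx.Pos <;> simp [hψ, ctx.neg_pos_iff hη, hp]
  have s1 : ∑ γ ∈ (ctx.Δ_finite.subset ctx.pos_subset).toFinset, f γ * ctx.B γ ctx.θ = c := by
    rw [ctx.sum_pos_eq_half_sum (fun γ => f γ * ctx.B γ ctx.θ) (by simp)]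
    have := congrArg f hc
    simp only [map_sum, map_smul, smul_eq_mul, hf] at this
    simp only [mul_comm (f _), this]
    ring
  have s2 : ∑ γ ∈ (ctx.Δ_finite.subset ctx.pos_subset).toFinset, ψ (u γ) =
      1 / 2 * ∑ η ∈ ctx.Δ_finite.toFinset, ψ η := by
    rw [ctx.sum_pos_eq_half_sum (fun γ => ψ (u γ))
      (fun η hη => by rw [map_neg]; exact hψe _ ((ha.mem_iff η).mpr hη)),
      ctx.sum_comp_equiv u ha.mem_iff ψ]
  have s3 : ∀ γ ∈ (ctx.Δ_finite.subset ctx.pos_subset).toFinset,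
      (if γ ∈ ctx.idealOf w then 1 else 0) * ctx.B γ ctx.θ =
        f γ * ctx.B γ ctx.θ - 1 / 2 * ctx.B γ ctx.θ - 1 / 2 * ψ (u γ) := by
    intro γ hγ
    rw [hw.indicator_eq ha (by simpa using hγ)]
    have : ctx.B γ ctx.θ = -ctx.B (u γ) μ := by rw [← ha.isom, hu, map_neg]
    simp only [hψ, this]
    ring
  rw [Finset.sum_congr rfl s3, Finset.sum_sub_distrib, Finset.sum_sub_distrib, s1,
    ← Finset.mul_sum, ← Finset.mul_sum, s2]
  ring

/-- If two minuscule elements have the same rootlet and comparable ideals, then the ideals differ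
only in roots orthogonal to `θ`. -/
theorem IsMinuscule.B_eq_zero_of_mem_diff {w w' : (V × ℚ × ℚ) ≃ₗ[ℚ] (V × ℚ × ℚ)}
    (hw : ctx.IsMinuscule w) (hw' : ctx.IsMinuscule w') {μ : V}
    (h : w ctx.alpha0 + ctx.δhat = ctx.emb μ) (h' : w' ctx.alpha0 + ctx.δhat = ctx.emb μ)
    (hsub : ctx.idealOf w ⊆ ctx.idealOf w') {γ : V} (hγ : γ ∈ ctx.idealOf w')
    (hγ' : γ ∉ ctx.idealOf w) : ctx.B γ ctx.θ = 0 := by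
  classical
  obtain ⟨c, hc⟩ := ctx.exists_casimir ctx.θ_mem
  have hs := (hw.sum_eq h hc).trans (hw'.sum_eq h' hc).symm
  have hle : ∀ x ∈ (ctx.Δ_finite.subset ctx.pos_subset).toFinset,
      (if x ∈ ctx.idealOf w then 1 else 0) * ctx.B x ctx.θ ≤
        (if x ∈ ctx.idealOf w' then 1 else 0) * ctx.B x ctx.θ := by
    intro x hx
    refine mul_le_mul_of_nonneg_right ?_ (ctx.B_θ_nonneg (by simpa using hx))
    by_cases h1 : x ∈ ctx.idealOf w
    · simp [h1, hsub h1]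
    · simp only [h1, if_false]; split_ifs <;> norm_num
  have := (Finset.sum_eq_sum_iff_of_le hle).mp hs γ (by simpa using hγ.1)
  simpa [hγ, hγ', eq_comm] using this

/-! ### Elements of minimal length taking `θ` to `μ` -/

theorem mem_Nfin {w : (V × ℚ × ℚ) ≃ₗ[ℚ] (V × ℚ × ℚ)} {u : V ≃ₗ[ℚ] V} (ha : ctx.AffAct w u 0)
    {γ : V} : γ ∈ ctx.Nfin w ↔ γ ∈ ctx.Pos ∧ -u γ ∈ ctx.Pos := by
  have : -w (ctx.emb γ) = (-u γ, 0, 0) := by rw [emb, ha.act]; simp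
  rw [Nfin, Set.mem_ofPred_eq, this, mem_PosHat_zero]

theorem Nfin_finite (w : (V × ℚ × ℚ) ≃ₗ[ℚ] (V × ℚ × ℚ)) : (ctx.Nfin w).Finite :=
  ctx.Δ_finite.subset fun _ h => ctx.pos_subset h.1

/-- If `w` makes `γ` negative, then `w s_γ` is shorter than `w`. -/
theorem lenFin_mul_refl_lt {w : (V × ℚ × ℚ) ≃ₗ[ℚ] (V × ℚ × ℚ)} {u : V ≃ₗ[ℚ] V}
    (ha : ctx.AffAct w u 0) {γ : V} (hγ : γ ∈ ctx.Pos) (hu : -u γ ∈ ctx.Pos) :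
    ctx.lenFin (w * ctx.refl (γ, 0, 0)) < ctx.lenFin w := by
  classical
  have hΔ := ctx.pos_subset hγ
  have hr : ctx.AffAct (w * ctx.refl (γ, 0, 0)) ((ctx.sV hΔ).trans u) 0 := by
    simpa using ha.mul (ctx.affAct_refl hΔ 0)
  have hle : ctx.lenFin (w * ctx.refl (γ, 0, 0)) ≤ (ctx.Nfin w \ {γ}).ncard := by
    refine Set.ncard_le_ncard_of_injOn
      (fun β => if ctx.sV hΔ β ∈ ctx.Pos then ctx.sV hΔ β else β) ?_ ?_
      ((Nfin_finite w).subset Set.sdiff_subset)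
    · intro β hβ
      obtain ⟨hβ1, hβ2⟩ := (mem_Nfin hr).mp hβ
      simp only [LinearEquiv.trans_apply] at hβ2
      have hsγ : ctx.sV hΔ γ = -γ := by rw [sV_apply, ctx.pair_self hΔ]; module
      split_ifs with hs
      · refine ⟨(mem_Nfin ha).mpr ⟨hs, hβ2⟩, fun he => ?_⟩
        have he : ctx.sV hΔ β = γ := he
        have : β = -γ := by
          have := congrArg (ctx.sV hΔ) he
          rwa [sV_sV, hsγ] at this
        exact ctx.pos_not_neg γ hγ (this ▸ hβ1)
      · have hsΔ := ctx.sV_mem hΔ (ctx.pos_subset hβ1)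
        have hsn := (ctx.neg_pos_iff hsΔ).mpr hs
        obtain ⟨k, hk⟩ := ctx.pair_int hΔ (ctx.pos_subset hβ1)
        have hsa : ctx.sV hΔ β = β - (k : ℚ) • γ := by rw [sV_apply, hk]
        have hk0 : 0 ≤ k := by
          by_contra hneg
          obtain ⟨m, hm⟩ := Int.eq_ofNat_of_zero_le (by omega : 0 ≤ -k)
          refine ctx.neg_pos_notMem_closure hsn ?_
          have : ctx.sV hΔ β = β + m • γ := by
            have hkm : (k : ℚ) = -m := by
              have : k = -m := by omega
              rw [this]; push_cast; ring
            rw [hsa, hkm, ← Nat.cast_smul_eq_nsmul ℚ]; module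
          rw [this]
          exact add_mem (ctx.pos_mem_closure hβ1) (nsmul_mem (ctx.pos_mem_closure hγ) m)
        obtain ⟨m, hm⟩ := Int.eq_ofNat_of_zero_le hk0
        refine ⟨(mem_Nfin ha).mpr ⟨hβ1, ?_⟩, fun he => ?_⟩
        · apply ctx.pos_of_mem_closure
            (ctx.neg_mem_Δ _ ((ha.mem_iff β).mpr (ctx.pos_subset hβ1)))
          have : -u β = -u (ctx.sV hΔ β) + m • -u γ := by
            rw [hsa, hm, ← Nat.cast_smul_eq_nsmul ℚ, map_sub, map_smul]
            simp only [Int.cast_natCast]; module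
          rw [this]
          exact add_mem (ctx.pos_mem_closure hβ2) (nsmul_mem (ctx.pos_mem_closure hu) m)
        · have he : β = γ := he
          subst he
          rw [hsγ, map_neg, neg_neg] at hβ2
          exact ctx.pos_not_neg _ hβ2 hu
    · intro β hβ β' hβ' h
      have p := hβ.1
      have p' := hβ'.1
      dsimp only at h
      split_ifs at h with h1 h2 h2
      · exact (ctx.sV hΔ).injective h
      · exact (h2 (by rw [← h, sV_sV]; exact p)).elim
      · exact (h1 (by rw [h, sV_sV]; exact p')).elim
      · exact h
  exact hle.trans_lt (Set.ncard_sdiff_singleton_lt_of_mem ((mem_Nfin ha).mpr ⟨hγ, hu⟩)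
    (Nfin_finite w))

theorem pos_of_minimal_length {μ : V} {w : (V × ℚ × ℚ) ≃ₗ[ℚ] (V × ℚ × ℚ)} (hw : w ∈ ctx.Wfin)
    (hθ : w (ctx.emb ctx.θ) = ctx.emb μ)
    (hmin : ∀ v ∈ ctx.Wfin, v (ctx.emb ctx.θ) = ctx.emb μ → ctx.lenFin w ≤ ctx.lenFin v)
    {u : V ≃ₗ[ℚ] V} (ha : ctx.AffAct w u 0) {γ : V} (hγ : γ ∈ ctx.Pos)
    (h0 : ctx.B γ ctx.θ = 0) : u γ ∈ ctx.Pos := by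
  by_contra hc
  have hΔ := ctx.pos_subset hγ
  have hu := (ctx.neg_pos_iff ((ha.mem_iff γ).mpr hΔ)).mpr hc
  refine (lenFin_mul_refl_lt ha hγ hu).not_ge (hmin _ (mul_mem hw (Subgroup.subset_closure
    ⟨γ, hΔ, rfl⟩)) ?_)
  have : ctx.sV hΔ ctx.θ = ctx.θ := by
    rw [sV_apply, pair_apply, ctx.B_symm, h0]; simp
  rw [LinearEquiv.mul_apply, emb, ctx.refl_finite_apply hΔ, this]
  exact hθ

/-! ### The minimal ideal with rootlet `μ` and its extensions -/

/-- `w` acts through `u ∈ W`, sends `θ` to the positive root `μ`, and preserves the positivity of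
the roots orthogonal to `θ`. -/
structure IsMinimalTo (ctx : RootSystemCtx V) (μ : V) (w : (V × ℚ × ℚ) ≃ₗ[ℚ] (V × ℚ × ℚ))
    (u : V ≃ₗ[ℚ] V) : Prop where
  mem : w ∈ ctx.What
  act : ctx.AffAct w u 0
  map_θ : u ctx.θ = μ
  pos : μ ∈ ctx.Pos
  map_orthogonal : ∀ γ ∈ ctx.Pos, ctx.B γ ctx.θ = 0 → u γ ∈ ctx.Pos

theorem pair_θ_sub {y : V} (hy : ctx.pair ctx.θ y = 1) : ctx.pair ctx.θ (ctx.θ - y) = 1 := by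
  rw [map_sub, ctx.pair_self ctx.θ_mem, hy]; norm_num

theorem refl_alpha0_sub {y : V} (hy : ctx.pair ctx.θ y = 1) :
    ctx.refl ctx.alpha0 (-(ctx.θ - y), 1, 0) = (y, 0, 0) := by
  rw [refl_alpha0_apply, sV_apply, map_neg, pair_θ_sub hy]
  simp

variable {μ : V} {v : (V × ℚ × ℚ) ≃ₗ[ℚ] (V × ℚ × ℚ)} {u : V ≃ₗ[ℚ] V}

theorem IsMinimalTo.sub_mem_idealOf (h : IsMinimalTo ctx μ v u) {y : V}
    (hy : ctx.pair ctx.θ y = 1) (hp : ctx.θ - y ∈ ctx.Pos) :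
    ctx.θ - y ∈ ctx.idealOf (v * ctx.refl ctx.alpha0) ↔ -u y ∈ ctx.Pos := by
  rw [mem_idealOf hp, LinearEquiv.mul_apply, refl_alpha0_sub hy, h.act.act]
  simpa using ctx.mem_PosHat_zero (x := -u y)

theorem IsMinimalTo.apply_alpha0 (h : IsMinimalTo ctx μ v u) :
    (v * ctx.refl ctx.alpha0) ctx.alpha0 = (μ, -1, 0) := by
  rw [LinearEquiv.mul_apply, refl_alpha0_alpha0, map_neg, alpha0, h.act.act, map_neg, h.map_θ]
  simp

theorem IsMinimalTo.mem_Nhat (h : IsMinimalTo ctx μ v u) {β : V × ℚ × ℚ}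
    (hβ : β ∈ ctx.Nhat (v * ctx.refl ctx.alpha0)) :
    ∃ γ ∈ ctx.Pos, 0 < ctx.B γ ctx.θ ∧ β = ctx.δhat - ctx.emb γ := by
  rcases eq_or_ne β ctx.alpha0 with rfl | hne
  · exact ⟨ctx.θ, ctx.θ_pos, ctx.B_self_pos ctx.θ_mem, by simp [alpha0, δhat, emb]⟩
  obtain ⟨h1, h2⟩ := hβ
  have h3 := ctx.refl_alpha0_mem_PosHat h1 hne
  obtain ⟨x, hx, k, rfl⟩ := ctx.exists_of_mem_PosHat h1
  obtain ⟨n, hn⟩ := ctx.pair_int ctx.θ_mem hx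
  rw [LinearEquiv.mul_apply] at h2
  rw [refl_alpha0_apply, hn, ← Int.cast_add] at h2 h3
  have e : -v (ctx.sV ctx.θ_mem x, ((k + n : ℤ) : ℚ), 0) =
      (-u (ctx.sV ctx.θ_mem x), ((-(k + n) : ℤ) : ℚ), 0) := by
    rw [h.act.act]; simp
  rw [e, mem_PosHat] at h2
  rw [mem_PosHat] at h3
  set y := ctx.sV ctx.θ_mem x with hy
  have hxy : x = y - ctx.pair ctx.θ y • ctx.θ := by rw [← sV_apply ctx ctx.θ_mem, hy, sV_sV]
  have hkn : k + n = 0 := by omega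
  have hyp : y ∈ ctx.Pos := by rcases h3.2 with h3 | h3 <;> [omega; exact h3.2]
  have huy : -u y ∈ ctx.Pos := by rcases h2.2 with h2 | h2 <;> [omega; exact h2.2]
  rcases ctx.pos_trichotomy hyp with hc | hc | ⟨hc, hc'⟩
  · rw [hc, h.map_θ] at huy
    exact (ctx.pos_not_neg _ h.pos huy).elim
  · exact (ctx.pos_not_neg _ (h.map_orthogonal y hyp (ctx.pair_θ_eq_zero_iff.mp hc)) huy).elim
  · refine ⟨ctx.θ - y, hc', ctx.pair_θ_pos_iff.mp (by rw [pair_θ_sub hc]; norm_num), ?_⟩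
    have hn1 : n = -1 := by
      have : ctx.pair ctx.θ x = -1 := by
        rw [hxy, hc, map_sub, map_smul, ctx.pair_self ctx.θ_mem, hc]; norm_num
      rw [hn] at this
      exact_mod_cast this
    have hk1 : k = 1 := by omega
    rw [hxy, hc, hk1]
    simp [δhat, emb]

theorem IsMinimalTo.isMinuscule (h : IsMinimalTo ctx μ v u) :
    ctx.IsMinuscule (v * ctx.refl ctx.alpha0) :=
  ⟨mul_mem h.mem ctx.refl_alpha0_mem, fun _ hβ =>
    let ⟨γ, hγ, _, e⟩ := h.mem_Nhat hβ; ⟨γ, hγ, e⟩⟩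

theorem IsMinimalTo.rootlet (h : IsMinimalTo ctx μ v u) :
    (v * ctx.refl ctx.alpha0) ctx.alpha0 + ctx.δhat = ctx.emb μ := by
  rw [h.apply_alpha0]; simp [δhat, emb]

theorem IsMinimalTo.B_pos_of_mem (h : IsMinimalTo ctx μ v u) {γ : V}
    (hγ : γ ∈ ctx.idealOf (v * ctx.refl ctx.alpha0)) : 0 < ctx.B γ ctx.θ := by
  obtain ⟨γ', _, h1, h2⟩ := h.mem_Nhat hγ.2
  have : γ = γ' := by simpa [emb, δhat] using h2
  rwa [this]

theorem IsMinimalTo.θ_mem_idealOf (h : IsMinimalTo ctx μ v u) :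
    ctx.θ ∈ ctx.idealOf (v * ctx.refl ctx.alpha0) := by
  rw [mem_idealOf ctx.θ_pos, ← alpha0, h.apply_alpha0]
  simpa using neg_mem_PosHat h.pos (k := 1) one_pos

theorem IsMinimalTo.mem_AbFiber (h : IsMinimalTo ctx μ v u) :
    ctx.idealOf (v * ctx.refl ctx.alpha0) ∈ ctx.AbFiber μ :=
  ⟨⟨_, h.θ_mem_idealOf⟩, _, h.isMinuscule, rfl, h.rootlet⟩

theorem IsMinimalTo.apply_symm_pos (h : IsMinimalTo ctx μ v u)
    {w : (V × ℚ × ℚ) ≃ₗ[ℚ] (V × ℚ × ℚ)} (hw : ctx.IsMinuscule w)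
    (hr : w ctx.alpha0 + ctx.δhat = ctx.emb μ)
    (hsub : ctx.idealOf (v * ctx.refl ctx.alpha0) ⊆ ctx.idealOf w) {η : V} (hη : η ∈ ctx.Pos) :
    w (ctx.refl ctx.alpha0 (u.symm η, 0, 0)) ∈ ctx.PosHat := by
  have hb : u.symm η ∈ ctx.Δ := by rw [← h.act.mem_iff]; simpa using ctx.pos_subset hη
  have hub : u (u.symm η) = η := by simp
  set b := u.symm η
  rcases ctx.mem_pos_or_neg_pos b hb with hp | hp
  · rcases ctx.pos_trichotomy hp with hc | hc | ⟨hc, hc'⟩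
    · have e : ctx.refl ctx.alpha0 (ctx.θ, 0, 0) = ctx.alpha0 + (2 : ℚ) • (0, 1, 0) -
          (0, 1, 0) := by
        rw [refl_alpha0_apply, sV_apply, ctx.pair_self ctx.θ_mem]
        simp only [alpha0, Prod.smul_mk, Prod.mk_add_mk, Prod.mk_sub_mk, Prod.mk.injEq]
        refine ⟨by module, by norm_num, by norm_num⟩
      obtain ⟨u', f, ha⟩ := ctx.exists_affAct hw.1
      obtain ⟨hu, hf⟩ := affAct_rootlet ha hr
      rw [hc, e]
      have : w (ctx.alpha0 + (2 : ℚ) • (0, 1, 0) - (0, 1, 0)) = (μ, 0, 0) := by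
        simp only [alpha0, Prod.smul_mk, Prod.mk_add_mk, Prod.mk_sub_mk]
        norm_num
        rw [ha.act]
        simp [hu, hf]
      rw [this]
      exact ctx.mem_PosHat_zero.mpr h.pos
    · rw [refl_alpha0_apply, sV_apply, hc]
      simpa using hw.apply_pos hp
    · have hrefl : ctx.refl ctx.alpha0 (b, 0, 0) = (-(ctx.θ - b), 1, 0) := by
        rw [← refl_alpha0_sub hc, refl_alpha0_involutive]
      rw [hrefl]
      obtain ⟨u', f, ha⟩ := ctx.exists_affAct hw.1
      have hd := ha.mem_PosHat_or_neg (ctx.neg_mem_Δ _ (ctx.pos_subset hc')) 1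
      simp only [Int.cast_one] at hd
      refine hd.resolve_right fun hneg => ?_
      have hJ := (mem_idealOf hc').mpr hneg
      have hC : ctx.θ - b ∈ ctx.idealOf (v * ctx.refl ctx.alpha0) := by
        by_contra hC
        have h0 := h.isMinuscule.B_eq_zero_of_mem_diff hw h.rootlet hr hsub hJ hC
        have := pair_θ_sub hc
        rw [ctx.pair_θ_eq_zero_iff.mpr h0] at this
        norm_num at this
      rw [h.sub_mem_idealOf hc hc', hub] at hC
      exact ctx.pos_not_neg _ hη hC
  · have hu : -u (-b) ∈ ctx.Pos := by rw [map_neg, neg_neg, hub]; exact hη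
    rcases ctx.pos_trichotomy hp with hc | hc | ⟨hc, hc'⟩
    · rw [hc, h.map_θ] at hu
      exact (ctx.pos_not_neg _ h.pos hu).elim
    · exact (ctx.pos_not_neg _ (h.map_orthogonal _ hp (ctx.pair_θ_eq_zero_iff.mp hc)) hu).elim
    · have hJ := hsub ((h.sub_mem_idealOf hc hc').mpr hu)
      rw [mem_idealOf hc'] at hJ
      have hrefl : ctx.refl ctx.alpha0 (-b, 0, 0) = (-(ctx.θ - -b), 1, 0) := by
        rw [← refl_alpha0_sub hc, refl_alpha0_involutive]
      rw [← hrefl, ← map_neg, ← map_neg] at hJ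
      simpa using hJ

/-- Any proper extension of the minimal ideal within its fiber makes `w_μ⁻¹(δ - θ)` negative. -/
theorem IsMinimalTo.neg_apply_mem (h : IsMinimalTo ctx μ v u)
    {w : (V × ℚ × ℚ) ≃ₗ[ℚ] (V × ℚ × ℚ)} (hw : ctx.IsMinuscule w)
    (hr : w ctx.alpha0 + ctx.δhat = ctx.emb μ)
    (hsub : ctx.idealOf (v * ctx.refl ctx.alpha0) ⊆ ctx.idealOf w)
    (hne : ¬ctx.idealOf w ⊆ ctx.idealOf (v * ctx.refl ctx.alpha0)) :
    w (ctx.refl ctx.alpha0 (-u.symm ctx.θ, 1, 0)) ∉ ctx.PosHat := by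
  intro hpos
  obtain ⟨ν, hν, hν'⟩ := Set.not_subset.mp hne
  have h0 := h.isMinuscule.B_eq_zero_of_mem_diff hw h.rootlet hr hsub hν hν'
  have hneg := (mem_idealOf hν.1).mp hν
  have hcl : ∀ p ∈ AddSubmonoid.closure ctx.Pos,
      w (ctx.refl ctx.alpha0 (u.symm p, 0, 0)) ∈ AddSubmonoid.closure ctx.PosHat := by
    intro p hp
    induction hp using AddSubmonoid.closure_induction with
    | mem x hx => exact AddSubmonoid.subset_closure (h.apply_symm_pos hw hr hsub hx)
    | zero =>
      have : (u.symm 0, (0 : ℚ), (0 : ℚ)) = 0 := by simp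
      rw [this, map_zero, map_zero]
      exact zero_mem _
    | add x y _ _ hx hy =>
      have : (u.symm (x + y), (0 : ℚ), (0 : ℚ)) = (u.symm x, 0, 0) + (u.symm y, 0, 0) := by simp
      rw [this, map_add, map_add]
      exact add_mem hx hy
  have hθ := hcl _ (ctx.θ_highest (u ν) ((h.act.mem_iff ν).mpr (ctx.pos_subset hν.1)))
  refine ctx.neg_notMem_closure_PosHat hneg ?_
  have e1 : ctx.refl ctx.alpha0 (-ν, 1, 0) = (-ν, 1, 0) := by
    rw [refl_alpha0_apply, sV_apply, map_neg, ctx.pair_θ_eq_zero_iff.mpr h0]; simp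
  have e2 : (-ν, (1 : ℚ), (0 : ℚ)) = (-u.symm ctx.θ, 1, 0) + (u.symm (ctx.θ - u ν), 0, 0) := by
    simp [neg_add_eq_sub]
  rw [← e1, e2, map_add, map_add]
  exact add_mem (AddSubmonoid.subset_closure hpos) hθ

theorem IsMinimalTo.apply_mem_of_ne_zero (h : IsMinimalTo ctx μ v u)
    {w : (V × ℚ × ℚ) ≃ₗ[ℚ] (V × ℚ × ℚ)} (hw : ctx.IsMinuscule w)
    (hr : w ctx.alpha0 + ctx.δhat = ctx.emb μ) (hμθ : ctx.B μ ctx.θ ≠ 0) :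
    w (ctx.refl ctx.alpha0 (-u.symm ctx.θ, 1, 0)) ∈ ctx.PosHat := by
  have hγ : u.symm ctx.θ ∈ ctx.Δ := by rw [← h.act.mem_iff]; simpa using ctx.θ_mem
  have hB : ctx.B (u.symm ctx.θ) ctx.θ = ctx.B μ ctx.θ := by
    rw [← h.act.isom, h.map_θ, LinearEquiv.apply_symm_apply, ctx.B_symm]
  set γ := u.symm ctx.θ
  have hBpos : 0 < ctx.B γ ctx.θ := hB ▸ lt_of_le_of_ne (ctx.B_θ_nonneg h.pos) hμθ.symm
  rcases ctx.mem_pos_or_neg_pos γ hγ with hp | hp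
  · rcases ctx.pos_trichotomy hp with hc | hc | ⟨hc, hc'⟩
    · have e : -w ctx.alpha0 = (-μ, 1, 0) := by
        rw [eq_sub_of_add_eq hr]; simp [emb, δhat]
      rw [hc, ← alpha0, refl_alpha0_alpha0, map_neg, e]
      simpa using neg_mem_PosHat h.pos (k := 1) one_pos
    · exact (hBpos.ne' (ctx.pair_θ_eq_zero_iff.mp hc)).elim
    · have := refl_alpha0_sub (pair_θ_sub hc)
      rw [sub_sub_cancel] at this
      rw [this]
      exact hw.apply_pos hc'
  · have := ctx.B_θ_nonneg hp
    rw [map_neg, LinearMap.neg_apply] at this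
    linarith

theorem IsMinimalTo.B_symm_θ (h : IsMinimalTo ctx μ v u) (hμθ : ctx.B μ ctx.θ = 0) :
    ctx.B (u.symm ctx.θ) ctx.θ = 0 := by
  rw [← h.act.isom, h.map_θ, LinearEquiv.apply_symm_apply, ctx.B_symm, hμθ]

theorem IsMinimalTo.symm_θ_pos (h : IsMinimalTo ctx μ v u) (hμθ : ctx.B μ ctx.θ = 0) :
    u.symm ctx.θ ∈ ctx.Pos := by
  have hγ : u.symm ctx.θ ∈ ctx.Δ := by rw [← h.act.mem_iff]; simpa using ctx.θ_mem
  refine (ctx.mem_pos_or_neg_pos _ hγ).resolve_right fun hp => ?_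
  have := h.map_orthogonal _ hp (by simp [h.B_symm_θ hμθ])
  rw [map_neg, LinearEquiv.apply_symm_apply] at this
  exact ctx.pos_not_neg _ ctx.θ_pos this

theorem IsMinimalTo.refl_symm_θ (h : IsMinimalTo ctx μ v u) (hμθ : ctx.B μ ctx.θ = 0) :
    ctx.refl ctx.alpha0 (-u.symm ctx.θ, 1, 0) = (-u.symm ctx.θ, 1, 0) := by
  rw [refl_alpha0_apply, sV_apply, map_neg, ctx.pair_θ_eq_zero_iff.mpr (h.B_symm_θ hμθ)]
  simp

theorem IsMinimalTo.apply_symm_θ (h : IsMinimalTo ctx μ v u) (hμθ : ctx.B μ ctx.θ = 0) :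
    (v * ctx.refl ctx.alpha0) (-u.symm ctx.θ, 1, 0) = ctx.alpha0 := by
  rw [LinearEquiv.mul_apply, h.refl_symm_θ hμθ, h.act.act]
  simp [alpha0]

theorem IsMinimalTo.Nhat_extension (h : IsMinimalTo ctx μ v u) (hμθ : ctx.B μ ctx.θ = 0) :
    ctx.Nhat (ctx.refl ctx.alpha0 * v * ctx.refl ctx.alpha0) =
      insert (-u.symm ctx.θ, 1, 0) (ctx.Nhat (v * ctx.refl ctx.alpha0)) := by
  have hγ := h.symm_θ_pos hμθ
  have hα := h.apply_symm_θ hμθ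
  have hpos : (-u.symm ctx.θ, (1 : ℚ), (0 : ℚ)) ∈ ctx.PosHat := by
    simpa using neg_mem_PosHat hγ (k := 1) one_pos
  have hα0 : ctx.alpha0 ∈ ctx.PosHat := by
    simpa [alpha0] using neg_mem_PosHat ctx.θ_pos (k := 1) one_pos
  rw [mul_assoc]
  set y := v * ctx.refl ctx.alpha0
  ext β
  rw [Set.mem_insert_iff]
  constructor
  · rintro ⟨h1, h2⟩
    rw [LinearEquiv.mul_apply] at h2
    by_cases hβ : y β = ctx.alpha0
    · exact Or.inl (y.injective (hβ.trans hα.symm))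
    refine Or.inr ⟨h1, ?_⟩
    obtain ⟨_, _, ha⟩ := ctx.exists_affAct h.isMinuscule.1
    obtain ⟨x, hx, k, rfl⟩ := ctx.exists_of_mem_PosHat h1
    exact (ha.mem_PosHat_or_neg hx k).resolve_left fun hc =>
      ctx.neg_notMem_PosHat (ctx.refl_alpha0_mem_PosHat hc hβ) h2
  · rintro (rfl | ⟨h1, h2⟩)
    · refine ⟨hpos, ?_⟩
      rw [LinearEquiv.mul_apply, hα, refl_alpha0_alpha0, neg_neg]
      exact hα0
    · refine ⟨h1, ?_⟩
      rw [LinearEquiv.mul_apply, ← map_neg]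
      refine ctx.refl_alpha0_mem_PosHat h2 fun hc => ?_
      have : β = -(-u.symm ctx.θ, 1, 0) := by
        apply y.injective
        rw [map_neg, hα, ← hc, neg_neg]
      exact ctx.neg_notMem_PosHat hpos (this ▸ h1)

theorem IsMinimalTo.isMinuscule_extension (h : IsMinimalTo ctx μ v u) (hμθ : ctx.B μ ctx.θ = 0) :
    ctx.IsMinuscule (ctx.refl ctx.alpha0 * v * ctx.refl ctx.alpha0) := by
  refine ⟨mul_mem (mul_mem ctx.refl_alpha0_mem h.mem) ctx.refl_alpha0_mem, fun β hβ => ?_⟩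
  rw [h.Nhat_extension hμθ] at hβ
  rcases hβ with rfl | hβ
  · exact ⟨_, h.symm_θ_pos hμθ, by simp [δhat, emb]⟩
  · exact h.isMinuscule.2 β hβ

theorem IsMinimalTo.idealOf_extension (h : IsMinimalTo ctx μ v u) (hμθ : ctx.B μ ctx.θ = 0) :
    ctx.idealOf (ctx.refl ctx.alpha0 * v * ctx.refl ctx.alpha0) =
      insert (u.symm ctx.θ) (ctx.idealOf (v * ctx.refl ctx.alpha0)) := by
  ext γ
  rw [Set.mem_insert_iff]
  change γ ∈ ctx.Pos ∧ _ ∈ ctx.Nhat _ ↔ _ ∨ γ ∈ ctx.Pos ∧ _ ∈ ctx.Nhat _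
  rw [h.Nhat_extension hμθ, Set.mem_insert_iff]
  have : ctx.δhat - ctx.emb γ = (-u.symm ctx.θ, 1, 0) ↔ γ = u.symm ctx.θ := by
    simp [δhat, emb]
  rw [this, and_or_left]
  refine or_congr ⟨fun h => h.2, fun e => ⟨e ▸ h.symm_θ_pos hμθ, e⟩⟩ Iff.rfl

theorem IsMinimalTo.extension_mem_AbFiber (h : IsMinimalTo ctx μ v u) (hμθ : ctx.B μ ctx.θ = 0) :
    insert (u.symm ctx.θ) (ctx.idealOf (v * ctx.refl ctx.alpha0)) ∈ ctx.AbFiber μ := by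
  refine ⟨Set.insert_nonempty _ _, _, h.isMinuscule_extension hμθ, h.idealOf_extension hμθ, ?_⟩
  rw [mul_assoc, LinearEquiv.mul_apply, h.apply_alpha0, refl_alpha0_apply, sV_apply,
    ctx.pair_θ_eq_zero_iff.mpr hμθ]
  simp [δhat, emb]

theorem AbFiber_finite (μ : V) : (ctx.AbFiber μ).Finite := by
  refine (ctx.Δ_finite.subset ctx.pos_subset).finite_subsets.subset ?_
  rintro I ⟨_, w, _, rfl, _⟩
  exact fun _ h => h.1

end RootSystemCtx
/-- Theorem `cardinal`: (i) `#(Ab_μ) > 1` iff `(μ,θ) = 0`;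
(ii) if `(μ,θ) = 0`, then `Ab_μ \ {I(μ)_min}` has the unique minimal element
`I′ = I(μ)_min ∪ {w_μ⁻¹(θ)}`, whose minuscule element is `s₀·w_μ·s₀`. -/
theorem statement_19 {V : Type*} [AddCommGroup V] [Module ℚ V] (ctx : RootSystemCtx V)
    (μ : V) (hμ : μ ∈ ctx.PosLong)
    (wμ : (V × ℚ × ℚ) ≃ₗ[ℚ] (V × ℚ × ℚ)) (hwμ : wμ ∈ ctx.Wfin)
    (hwθ : wμ (ctx.emb ctx.θ) = ctx.emb μ)
    (hminlen : ∀ u ∈ ctx.Wfin, u (ctx.emb ctx.θ) = ctx.emb μ →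
      ctx.lenFin wμ ≤ ctx.lenFin u)
    (Imin : Set V) (hImin : Imin ∈ ctx.AbFiber μ)
    (hleast : ∀ I ∈ ctx.AbFiber μ, Imin ⊆ I) :
    (1 < (ctx.AbFiber μ).ncard ↔ ctx.B μ ctx.θ = 0) ∧
    (ctx.B μ ctx.θ = 0 →
      ∃ γ : V, ctx.emb γ = wμ⁻¹ (ctx.emb ctx.θ) ∧
        insert γ Imin ∈ ctx.AbFiber μ ∧ insert γ Imin ≠ Imin ∧
        (∀ J ∈ ctx.AbFiber μ, J ≠ Imin → insert γ Imin ⊆ J) ∧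
        ctx.IsMinuscule (ctx.refl ctx.alpha0 * wμ * ctx.refl ctx.alpha0) ∧
        ctx.idealOf (ctx.refl ctx.alpha0 * wμ * ctx.refl ctx.alpha0) =
          insert γ Imin) := by
  obtain ⟨u, ha⟩ := ctx.exists_affAct_Wfin hwμ
  have hθ : u ctx.θ = μ := by
    rw [RootSystemCtx.emb, ha.act] at hwθ
    exact congrArg Prod.fst hwθ
  have h : ctx.IsMinimalTo μ wμ u :=
    ⟨ctx.Wfin_le_What hwμ, ha, hθ, hμ.1, fun γ hγ h0 =>
      RootSystemCtx.pos_of_minimal_length hwμ hwθ hminlen ha hγ h0⟩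
  obtain rfl : Imin = ctx.idealOf (wμ * ctx.refl ctx.alpha0) := by
    obtain ⟨-, w, hw, rfl, hr⟩ := hImin
    have hsub := hleast _ h.mem_AbFiber
    refine hsub.antisymm fun γ hγ => ?_
    by_contra hc
    exact (h.B_pos_of_mem hγ).ne' (hw.B_eq_zero_of_mem_diff h.isMinuscule hr h.rootlet hsub hγ hc)
  have key : ∀ J ∈ ctx.AbFiber μ, J ≠ ctx.idealOf (wμ * ctx.refl ctx.alpha0) →
      ctx.B μ ctx.θ = 0 ∧ u.symm ctx.θ ∈ J := by
    intro J hJ hne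
    have hsub := hleast J hJ
    obtain ⟨-, w, hw, rfl, hr⟩ := hJ
    have hn := h.neg_apply_mem hw hr hsub fun hc => hne (hc.antisymm hsub)
    have h0 : ctx.B μ ctx.θ = 0 := by
      by_contra h0
      exact hn (h.apply_mem_of_ne_zero hw hr h0)
    refine ⟨h0, ?_⟩
    have hγ := h.symm_θ_pos h0
    rw [h.refl_symm_θ h0] at hn
    obtain ⟨_, _, ha'⟩ := ctx.exists_affAct hw.1
    have hd := ha'.mem_PosHat_or_neg (ctx.neg_mem_Δ _ (ctx.pos_subset hγ)) 1
    rw [Int.cast_one] at hd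
    exact (RootSystemCtx.mem_idealOf hγ).mpr (hd.resolve_left hn)
  have hins : ctx.B μ ctx.θ = 0 → insert (u.symm ctx.θ)
      (ctx.idealOf (wμ * ctx.refl ctx.alpha0)) ≠ ctx.idealOf (wμ * ctx.refl ctx.alpha0) := by
    intro h0 he
    exact (h.B_pos_of_mem (he ▸ Set.mem_insert _ _)).ne' (h.B_symm_θ h0)
  refine ⟨⟨fun hcard => ?_, fun h0 => ?_⟩, fun h0 => ⟨u.symm ctx.θ, ?_,
    h.extension_mem_AbFiber h0, hins h0, fun J hJ hne => ?_, h.isMinuscule_extension h0,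
    h.idealOf_extension h0⟩⟩
  · obtain ⟨J, hJ, hne⟩ := Set.exists_ne_of_one_lt_ncard hcard
      (ctx.idealOf (wμ * ctx.refl ctx.alpha0))
    exact (key J hJ hne).1
  · exact (Set.one_lt_ncard_iff (RootSystemCtx.AbFiber_finite μ)).mpr
      ⟨_, _, h.extension_mem_AbFiber h0, hImin, hins h0⟩
  · rw [RootSystemCtx.emb, RootSystemCtx.emb, ha.inv.act]
    simp
  · exact Set.insert_subset (key J hJ hne).2 (hleast J hJ)
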